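/- arXiv:1301.7349 — 3 statements merged into one kernel-verified Lean document; each statement's English description precedes it below -/
import Mathlib

section
/- Let f_1, f_2 : [0,∞) → ℝ be operator convex functions with f_1(0) ≤ 0 and f_2(0) ≤ 0, and let g_1, g_2 be their non-commutative perspective functions. The following are equivalent: (1) f_1(t) ≤ f_2(t) for all t ≥ 0; (2) g_1(Φ(A),Φ(B)) ≤ Φ(g_2(A,B)) for every complex Hilbert space H, every unital positive linear map Φ on the bounded operators on H, every positive operator A on H, and every strictly positive operator B on H. -/
open scoped InnerProductSpace

noncomputable section

/-- A continuous function `f : [0, ∞) → ℝ` is *operator convex* if for every complex Hilbert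
space `K`, all selfadjoint operators `A, B` on `K` with spectra in `[0, ∞)` and every
`λ ∈ [0, 1]` one has `f(λA + (1-λ)B) ≤ λ f(A) + (1-λ) f(B)` in the Loewner order, where
`f(A)` is given by the continuous functional calculus. -/
def OperatorConvexOn (f : ℝ → ℝ) : Prop :=
  ∀ (K : Type) [NormedAddCommGroup K] [InnerProductSpace ℂ K] [CompleteSpace K],
    ∀ A B : K →L[ℂ] K, IsSelfAdjoint A → IsSelfAdjoint B →
      spectrum ℝ A ⊆ Set.Ici (0 : ℝ) → spectrum ℝ B ⊆ Set.Ici (0 : ℝ) →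
      ∀ lam : ℝ, lam ∈ Set.Icc (0 : ℝ) 1 →
        cfc f (lam • A + (1 - lam) • B) ≤ lam • cfc f A + (1 - lam) • cfc f B

variable {H : Type} [NormedAddCommGroup H] [InnerProductSpace ℂ H] [CompleteSpace H]

/-- `R^{1/2}` via the continuous functional calculus. -/
def opSqrt (R : H →L[ℂ] H) : H →L[ℂ] H := cfc Real.sqrt R

/-- `R^{-1/2}` via the continuous functional calculus. -/
def opInvSqrt (R : H →L[ℂ] H) : H →L[ℂ] H := cfc (fun t : ℝ => (Real.sqrt t)⁻¹) R

/-- The non-commutative perspective `g(L, R) = R^{1/2} f(R^{-1/2} L R^{-1/2}) R^{1/2}`. -/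
def persp (f : ℝ → ℝ) (L R : H →L[ℂ] H) : H →L[ℂ] H :=
  opSqrt R * cfc f (opInvSqrt R * L * opInvSqrt R) * opSqrt R

open ContinuousLinearMap

variable {L : Type} [NormedAddCommGroup L] [InnerProductSpace ℂ L] [CompleteSpace L]

/-- The continuous functional calculus respects intertwining relations. -/
theorem cfc_comp_eq_comp_cfc {S : L →L[ℂ] L} {T : H →L[ℂ] H} {V : H →L[ℂ] L}
    (hS : IsSelfAdjoint S) (hT : IsSelfAdjoint T) (hV : S ∘L V = V ∘L T) {f : ℝ → ℝ}
    (hf : ContinuousOn f (spectrum ℝ S ∪ spectrum ℝ T)) :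
    cfc f S ∘L V = V ∘L cfc f T := by
  set s := spectrum ℝ S ∪ spectrum ℝ T
  have hsS : spectrum ℝ S ⊆ s := Set.subset_union_left
  have hsT : spectrum ℝ T ⊆ s := Set.subset_union_right
  have : CompactSpace s := isCompact_iff_compactSpace.mp
    ((ContinuousFunctionalCalculus.isCompact_spectrum S).union
      (ContinuousFunctionalCalculus.isCompact_spectrum T))
  have key : ∀ g : C(s, ℝ), cfcHomSuperset hS hsS g ∘L V = V ∘L cfcHomSuperset hT hsT g := by
    intro g
    induction g using ContinuousMap.induction_on_of_compact with
    | const r =>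
      have h : ContinuousMap.const s r = algebraMap ℝ C(s, ℝ) r := rfl
      rw [h, AlgHomClass.commutes, AlgHomClass.commutes]
      ext x
      simp [Algebra.algebraMap_eq_smul_one]
    | id => rw [cfcHomSuperset_id, cfcHomSuperset_id, hV]
    | star_id => rw [star_trivial, cfcHomSuperset_id, cfcHomSuperset_id, hV]
    | add g h hg hh => rw [map_add, map_add, add_comp, comp_add, hg, hh]
    | mul g h hg hh =>
      rw [map_mul, map_mul, mul_def, mul_def, comp_assoc, hh, ← comp_assoc, hg, comp_assoc]
    | frequently g hg =>
      exact hg.mem_of_closed <| isClosed_eq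
        ((cfcHomSuperset_continuous hS hsS).clm_comp continuous_const)
        (continuous_const.clm_comp (cfcHomSuperset_continuous hT hsT))
  have := key ⟨s.domRestrict f, hf.domRestrict⟩
  rw [cfc_apply f S hS (hf.mono hsS), cfc_apply f T hT (hf.mono hsT)]
  exact this

theorem spectrum_subset_Ici {T : H →L[ℂ] H} (hT : 0 ≤ T) : spectrum ℝ T ⊆ Set.Ici 0 :=
  fun _ hx => spectrum_nonneg_of_nonneg hT hx

/-- Jensen's operator inequality for compressions by an isometry. -/
theorem OperatorConvexOn.cfc_adjoint_conj_le {f : ℝ → ℝ} (hf : OperatorConvexOn f)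
    (hfc : ContinuousOn f (Set.Ici 0)) {V : H →L[ℂ] L} (hV : adjoint V ∘L V = 1)
    {X : L →L[ℂ] L} (hX : 0 ≤ X) :
    cfc f (adjoint V ∘L X ∘L V) ≤ adjoint V ∘L cfc f X ∘L V := by
  have hVx : ∀ x, adjoint V (V x) = x := fun x => congr($hV x)
  let U : L →L[ℂ] L := (2 : ℝ) • (V ∘L adjoint V) - 1
  have hU : IsSelfAdjoint U := by
    have h : IsSelfAdjoint (V ∘L adjoint V) := by
      rw [isSelfAdjoint_iff', adjoint_comp, adjoint_adjoint]
    exact (IsSelfAdjoint.smul (.all _) h).sub (.one _)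
  have hUV : ∀ x, U (V x) = V x := fun x => by simp [U, hVx, two_smul]
  have hVU : ∀ x, adjoint V (U x) = adjoint V x := fun x => by simp [U, hVx, two_smul]
  have hUU : ∀ x, U (U x) = x := fun x => by
    have : U (U x) = (2 : ℝ) • V (adjoint V (U x)) - U x := by simp [U]
    rw [this, hVU]
    simp [U]
  let Z : L →L[ℂ] L := U * X * U
  have hZ : 0 ≤ Z := hU.conjugate_nonneg hX
  let Y : L →L[ℂ] L := (1 / 2 : ℝ) • X + (1 - 1 / 2 : ℝ) • Z
  have hY : 0 ≤ Y := add_nonneg (smul_nonneg (by norm_num) hX) (smul_nonneg (by norm_num) hZ)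
  have hC : 0 ≤ adjoint V ∘L X ∘L V := by
    rw [nonneg_iff_isPositive] at hX ⊢
    exact hX.adjoint_conj V
  have hcont : ∀ {A : L →L[ℂ] L} {B : H →L[ℂ] H}, 0 ≤ A → 0 ≤ B →
      ContinuousOn f (spectrum ℝ A ∪ spectrum ℝ B) := fun hA hB =>
    hfc.mono (Set.union_subset (spectrum_subset_Ici hA) (spectrum_subset_Ici hB))
  have h1 : cfc f Y ∘L V = V ∘L cfc f (adjoint V ∘L X ∘L V) := by
    refine cfc_comp_eq_comp_cfc hY.isSelfAdjoint hC.isSelfAdjoint ?_ (hcont hY hC)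
    ext x
    have : V (adjoint V (X (V x))) = (1 / 2 : ℝ) • (X (V x) + U (X (V x))) := by
      simp [U]
    have hZx : Z (V x) = U (X (V x)) := congr(U (X $(hUV x)))
    simp only [Y, comp_apply, add_apply, smul_apply, hZx, this]
    module
  have h2 : cfc f Z ∘L U = U ∘L cfc f X := by
    refine cfc_comp_eq_comp_cfc hZ.isSelfAdjoint hX.isSelfAdjoint ?_
      (hfc.mono (Set.union_subset (spectrum_subset_Ici hZ) (spectrum_subset_Ici hX)))
    ext x
    simp [Z, hUU]
  have h3 := hf L X Z hX.isSelfAdjoint hZ.isSelfAdjoint (spectrum_subset_Ici hX)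
    (spectrum_subset_Ici hZ) (1 / 2) ⟨by norm_num, by norm_num⟩
  have h4 : adjoint V ∘L cfc f Y ∘L V ≤
      adjoint V ∘L ((1 / 2 : ℝ) • cfc f X + (1 - 1 / 2 : ℝ) • cfc f Z) ∘L V := by
    rw [le_def] at h3 ⊢
    have := h3.adjoint_conj V
    rwa [sub_comp, comp_sub] at this
  have h5 : adjoint V ∘L cfc f Y ∘L V = cfc f (adjoint V ∘L X ∘L V) := by
    rw [h1, ← comp_assoc, hV]; rfl
  have h6 : adjoint V ∘L ((1 / 2 : ℝ) • cfc f X + (1 - 1 / 2 : ℝ) • cfc f Z) ∘L V =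
      adjoint V ∘L cfc f X ∘L V := by
    ext x
    have : adjoint V (cfc f Z (V x)) = adjoint V (cfc f X (V x)) := by
      have h := congr($h2 (V x))
      simp only [comp_apply, hUV] at h
      rw [h, hVU]
    simp only [comp_apply, add_apply, smul_apply, map_add, map_smul_of_tower, this]
    module
  rwa [h5, h6] at h4

/-- Jensen's operator inequality for a finite positive resolution of the identity. -/
theorem OperatorConvexOn.cfc_sum_smul_le {f : ℝ → ℝ} (hf : OperatorConvexOn f)
    (hfc : ContinuousOn f (Set.Ici 0)) {n : ℕ} {t : Fin n → ℝ} (ht : ∀ i, 0 ≤ t i)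
    {P : Fin n → H →L[ℂ] H} (hP : ∀ i, 0 ≤ P i) (hsum : ∑ i, P i = 1) :
    cfc f (∑ i, t i • P i) ≤ ∑ i, f (t i) • P i := by
  let Q : Fin n → H →L[ℂ] H := fun i => CFC.sqrt (P i)
  have hQ : ∀ i x y, ⟪Q i x, Q i y⟫_ℂ = ⟪x, P i y⟫_ℂ := fun i x y => by
    have hsa : IsSelfAdjoint (Q i) := (CFC.sqrt_nonneg (P i)).isSelfAdjoint
    rw [← adjoint_inner_right, isSelfAdjoint_iff'.mp hsa]
    change ⟪x, (CFC.sqrt (P i) * CFC.sqrt (P i)) y⟫_ℂ = _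
    rw [CFC.sqrt_mul_sqrt_self (P i) (hP i)]
  obtain ⟨V, hVi⟩ : ∃ V : H →L[ℂ] PiLp 2 fun _ : Fin n => H, ∀ x i, V x i = Q i x :=
    ⟨(PiLp.continuousLinearEquiv 2 ℂ fun _ : Fin n => H).symm.toContinuousLinearMap ∘L
      ContinuousLinearMap.pi Q, fun _ _ => rfl⟩
  obtain ⟨D, hDi⟩ : ∃ D : (Fin n → ℝ) →
      (PiLp 2 fun _ : Fin n => H) →L[ℂ] PiLp 2 fun _ : Fin n => H, ∀ c x i, D c x i = c i • x i :=
    ⟨fun c => (PiLp.continuousLinearEquiv 2 ℂ fun _ : Fin n => H).symm.toContinuousLinearMap ∘L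
      ContinuousLinearMap.pi fun i => c i • PiLp.proj 2 (fun _ : Fin n => H) i, fun _ _ _ => rfl⟩
  have hVD : ∀ c, adjoint V ∘L D c ∘L V = ∑ i, c i • P i := fun c => by
    ext x
    refine ext_inner_left ℂ fun y => ?_
    simp only [comp_apply, adjoint_inner_right, PiLp.inner_apply, hVi, hDi, sum_apply, inner_sum,
      smul_apply, inner_smul_right_eq_smul, hQ]
  have hV : adjoint V ∘L V = 1 := by
    have h := hVD 1
    have h1 : D 1 = 1 := by
      ext x i
      simp [hDi]
    rw [h1] at h
    simpa [hsum, one_def] using h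
  have hX : 0 ≤ D t := by
    rw [nonneg_iff_isPositive, isPositive_iff_complex]
    intro x
    have : ⟪D t x, x⟫_ℂ = ((∑ i, t i * ‖x i‖ ^ 2 : ℝ) : ℂ) := by
      simp [PiLp.inner_apply, hDi, inner_smul_left_eq_smul, inner_self_eq_norm_sq_to_K]
    rw [this]
    rw [RCLike.re_to_complex, Complex.ofReal_re]
    exact ⟨rfl, Finset.sum_nonneg fun i _ => mul_nonneg (ht i) (sq_nonneg _)⟩
  have hfD : cfc f (D t) = D fun i => f (t i) := by
    ext x i
    have hpos : 0 ≤ t i • (1 : H →L[ℂ] H) := smul_nonneg (ht i) zero_le_one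
    obtain ⟨π, hπ⟩ : ∃ π : (PiLp 2 fun _ : Fin n => H) →L[ℂ] H, ∀ x, π x = x i :=
      ⟨PiLp.proj 2 (fun _ : Fin n => H) i, fun _ => rfl⟩
    have hπD : (t i • (1 : H →L[ℂ] H)) ∘L π = π ∘L D t := by
      ext x
      simp [hπ, hDi]
    have h := cfc_comp_eq_comp_cfc (f := f) hpos.isSelfAdjoint hX.isSelfAdjoint hπD
      (hfc.mono (Set.union_subset (spectrum_subset_Ici hpos) (spectrum_subset_Ici hX)))
    rw [← Algebra.algebraMap_eq_smul_one, cfc_algebraMap, Algebra.algebraMap_eq_smul_one] at h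
    simpa [hDi, hπ] using congr($h x).symm
  simpa only [hfD, hVD] using hf.cfc_adjoint_conj_le hfc hV hX

/-- Bernstein approximation on `[0, M]`, written with a partition of unity that reproduces the
identity function. -/
theorem exists_bernstein_approx {f : ℝ → ℝ} {M ε : ℝ} (hM : 0 < M) (hε : 0 < ε)
    (hf : ContinuousOn f (Set.Ici 0)) :
    ∃ (n : ℕ) (t : Fin n → ℝ) (p : Fin n → ℝ → ℝ), (∀ k, 0 ≤ t k) ∧ (∀ k, Continuous (p k)) ∧
      ∀ x ∈ Set.Icc 0 M, (∀ k, 0 ≤ p k x) ∧ ∑ k, p k x = 1 ∧ ∑ k, t k * p k x = x ∧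
        ∑ k, f (t k) * p k x ≤ f x + ε := by
  let g : C(unitInterval, ℝ) := ⟨fun u => f (M * u),
    hf.comp_continuous (by fun_prop) fun u => mul_nonneg hM.le u.2.1⟩
  have hlim := bernsteinApproximation_uniform g
  obtain ⟨n, hn, hn0⟩ := ((Metric.tendsto_nhds.mp hlim ε hε).and
    (Filter.eventually_ne_atTop 0)).exists
  have hn0' : (n : ℝ) ≠ 0 := by exact_mod_cast hn0
  refine ⟨n + 1, fun k => M * (k / n), fun k x => (bernsteinPolynomial ℝ n k).eval (x / M),
    fun k => by positivity, fun k => by fun_prop, fun x hx => ?_⟩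
  let u : unitInterval := ⟨x / M, div_nonneg hx.1 hM.le, (div_le_one hM).mpr hx.2⟩
  have hb : ∀ k : ℕ, (bernsteinPolynomial ℝ n k).eval (x / M) = bernstein n k u := fun _ => rfl
  refine ⟨fun k => (bernstein_nonneg : 0 ≤ bernstein n k u), ?_, ?_, ?_⟩
  · simpa only [hb] using bernstein.probability n u
  · have h := congrArg (Polynomial.eval (x / M)) (bernsteinPolynomial.sum_smul ℝ n)
    simp only [Polynomial.eval_finsetSum, Polynomial.eval_X, nsmul_eq_mul,
      Finset.sum_range, Polynomial.eval_mul, Polynomial.eval_natCast] at h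
    have h' : ∀ k : Fin (n + 1), M * (k / n) * (bernsteinPolynomial ℝ n k).eval (x / M) =
        M / n * (k * (bernsteinPolynomial ℝ n k).eval (x / M)) := fun k => by ring
    simp only [h', ← Finset.mul_sum, h]
    field_simp
  · have h := (ContinuousMap.dist_apply_le_dist u).trans hn.le
    rw [bernsteinApproximation.apply, Real.dist_eq] at h
    have hgu : g u = f x := congrArg f (mul_div_cancel₀ x hM.ne')
    have hgz : ∀ k : Fin (n + 1), g (bernstein.z k) = f (M * (k / n)) := fun _ => rfl
    simp only [hgu, hgz, smul_eq_mul] at h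
    simp only [hb, mul_comm (f _)]
    linarith [le_abs_self (∑ k : Fin (n + 1), bernstein n k u * f (M * (k / n)) - f x)]

theorem map_le_map_of_map_nonneg {Φ : (H →L[ℂ] H) →ₗ[ℂ] (H →L[ℂ] H)}
    (hΦ : ∀ A, 0 ≤ A → 0 ≤ Φ A) {A B : H →L[ℂ] H} (h : A ≤ B) : Φ A ≤ Φ B := by
  rw [← sub_nonneg, ← map_sub]
  exact hΦ _ (sub_nonneg.mpr h)

theorem le_of_forall_pos_le_add_smul_one {S T : H →L[ℂ] H}
    (h : ∀ ε : ℝ, 0 < ε → S ≤ T + ε • (1 : H →L[ℂ] H)) : S ≤ T := by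
  have hlim : Filter.Tendsto (fun ε : ℝ => T + ε • (1 : H →L[ℂ] H)) (nhdsWithin 0 (Set.Ioi 0))
      (nhds T) := by
    have : Continuous fun ε : ℝ => T + ε • (1 : H →L[ℂ] H) := by fun_prop
    simpa using (this.tendsto 0).mono_left nhdsWithin_le_nhds
  exact ge_of_tendsto hlim (Filter.eventually_of_mem self_mem_nhdsWithin h)

/-- The Davis–Choi–Jensen inequality for unital positive linear maps. -/
theorem OperatorConvexOn.cfc_map_le {f : ℝ → ℝ} (hf : OperatorConvexOn f)
    (hfc : ContinuousOn f (Set.Ici 0)) {Φ : (H →L[ℂ] H) →ₗ[ℂ] (H →L[ℂ] H)}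
    (hΦ : ∀ A, 0 ≤ A → 0 ≤ Φ A) (hΦ1 : Φ 1 = 1) {C : H →L[ℂ] H} (hC : 0 ≤ C) :
    cfc f (Φ C) ≤ Φ (cfc f C) := by
  have hsa : IsSelfAdjoint C := hC.isSelfAdjoint
  have hspec := spectrum_subset_Ici hC
  obtain ⟨M, hM, hCM⟩ : ∃ M > 0, spectrum ℝ C ⊆ Set.Icc 0 M := by
    obtain ⟨b, hb⟩ := (ContinuousFunctionalCalculus.isCompact_spectrum (R := ℝ) C).bddAbove
    exact ⟨max b 1, by positivity, fun x hx => ⟨hspec hx, (hb hx).trans (le_max_left _ _)⟩⟩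
  refine le_of_forall_pos_le_add_smul_one fun ε hε => ?_
  obtain ⟨n, t, p, ht, hp, hpx⟩ := exists_bernstein_approx hM hε hfc
  have hlin : ∀ c : Fin n → ℝ,
      ∑ k, c k • Φ (cfc (p k) C) = Φ (cfc (fun x => ∑ k, c k * p k x) C) := fun c => by
    have h : (fun x => ∑ k, c k * p k x) = ∑ k, fun x => c k * p k x := by
      ext x
      simp
    rw [h, cfc_sum_univ (fun k x => c k * p k x) C fun k => by fun_prop, map_sum]
    refine Finset.sum_congr rfl fun k _ => ?_
    rw [cfc_const_mul (c k) (p k) C (hp k).continuousOn, LinearMap.map_smul_of_tower]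
  have hnonneg : ∀ k, 0 ≤ Φ (cfc (p k) C) := fun k =>
    hΦ _ (cfc_nonneg fun x hx => (hpx x (hCM hx)).1 k)
  have hsum : ∑ k, Φ (cfc (p k) C) = 1 := by
    have h := hlin 1
    simp only [Pi.one_apply, one_smul, one_mul] at h
    rw [h, cfc_congr (g := fun _ => 1) fun x hx => (hpx x (hCM hx)).2.1, cfc_const_one ℝ C, hΦ1]
  have hid : ∑ k, t k • Φ (cfc (p k) C) = Φ C := by
    rw [hlin, cfc_congr (g := id) fun x hx => (hpx x (hCM hx)).2.2.1, cfc_id ℝ C]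
  have hfC : ContinuousOn f (spectrum ℝ C) := hfc.mono hspec
  calc cfc f (Φ C) ≤ ∑ k, f (t k) • Φ (cfc (p k) C) := by
        simpa only [hid] using hf.cfc_sum_smul_le hfc ht hnonneg hsum
    _ = Φ (cfc (fun x => ∑ k, f (t k) * p k x) C) := hlin _
    _ ≤ Φ (cfc (fun x => f x + ε) C) := map_le_map_of_map_nonneg hΦ
        (cfc_mono fun x hx => (hpx x (hCM hx)).2.2.2)
    _ = Φ (cfc f C) + ε • (1 : H →L[ℂ] H) := by
        rw [cfc_add_const ε f C, map_add, Algebra.algebraMap_eq_smul_one,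
          LinearMap.map_smul_of_tower, hΦ1]

theorem spectrum_subset_Ioi {R : H →L[ℂ] H} (hR : IsStrictlyPositive R) :
    spectrum ℝ R ⊆ Set.Ioi 0 := fun _ hx =>
  (StarOrderedRing.isStrictlyPositive_iff_spectrum_pos R hR.isSelfAdjoint).mp hR _ hx

theorem continuousOn_inv_sqrt_spectrum {R : H →L[ℂ] H} (hR : IsStrictlyPositive R) :
    ContinuousOn (fun t : ℝ => (√t)⁻¹) (spectrum ℝ R) :=
  Real.continuous_sqrt.continuousOn.inv₀ fun _ hx =>
    (Real.sqrt_pos.mpr (spectrum_subset_Ioi hR hx)).ne'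

theorem isSelfAdjoint_opSqrt (R : H →L[ℂ] H) : IsSelfAdjoint (opSqrt R) := cfc_predicate _ _

theorem isSelfAdjoint_opInvSqrt (R : H →L[ℂ] H) : IsSelfAdjoint (opInvSqrt R) :=
  cfc_predicate _ _

theorem opSqrt_mul_opSqrt {R : H →L[ℂ] H} (hR : 0 ≤ R) : opSqrt R * opSqrt R = R := by
  have hsa : IsSelfAdjoint R := hR.isSelfAdjoint
  rw [opSqrt, ← cfc_mul Real.sqrt Real.sqrt R,
    cfc_congr (f := fun x => √x * √x) (g := id) fun x hx =>
      Real.mul_self_sqrt (spectrum_subset_Ici hR hx), cfc_id ℝ R]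

theorem opSqrt_mul_opInvSqrt {R : H →L[ℂ] H} (hR : IsStrictlyPositive R) :
    opSqrt R * opInvSqrt R = 1 := by
  have hsa : IsSelfAdjoint R := hR.isSelfAdjoint
  rw [opSqrt, opInvSqrt, ← cfc_mul Real.sqrt _ R (by fun_prop) (continuousOn_inv_sqrt_spectrum hR),
    cfc_congr (g := fun _ => 1) fun x hx =>
      mul_inv_cancel₀ (Real.sqrt_pos.mpr (spectrum_subset_Ioi hR hx)).ne', cfc_const_one ℝ R]

theorem opInvSqrt_mul_opSqrt {R : H →L[ℂ] H} (hR : IsStrictlyPositive R) :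
    opInvSqrt R * opSqrt R = 1 := by
  rw [← opSqrt_mul_opInvSqrt hR]
  exact cfc_commute_cfc _ _ R

theorem opSqrt_conj_opInvSqrt_conj {R : H →L[ℂ] H} (hR : IsStrictlyPositive R) (X : H →L[ℂ] H) :
    opSqrt R * (opInvSqrt R * X * opInvSqrt R) * opSqrt R = X := by
  rw [mul_assoc (opInvSqrt R), ← mul_assoc, ← mul_assoc, opSqrt_mul_opInvSqrt hR, one_mul,
    mul_assoc, opInvSqrt_mul_opSqrt hR, mul_one]

theorem isStrictlyPositive_map {Φ : (H →L[ℂ] H) →ₗ[ℂ] (H →L[ℂ] H)}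
    (hΦ : ∀ A, 0 ≤ A → 0 ≤ Φ A) (hΦ1 : Φ 1 = 1) {B : H →L[ℂ] H} (hB : IsStrictlyPositive B) :
    IsStrictlyPositive (Φ B) := by
  rcases subsingleton_or_nontrivial (H →L[ℂ] H) with _ | _
  · exact ⟨hΦ B hB.nonneg, isUnit_of_subsingleton _⟩
  obtain ⟨r, hr, hrB⟩ := (CFC.exists_pos_algebraMap_le_iff hB.isSelfAdjoint).mpr
    fun x hx => spectrum_subset_Ioi hB hx
  have h := map_le_map_of_map_nonneg hΦ hrB
  rw [Algebra.algebraMap_eq_smul_one, LinearMap.map_smul_of_tower, hΦ1] at h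
  rw [StarOrderedRing.isStrictlyPositive_iff_spectrum_pos (R := ℝ) _ (hΦ B hB.nonneg).isSelfAdjoint]
  refine (CFC.exists_pos_algebraMap_le_iff (hΦ B hB.nonneg).isSelfAdjoint).mp ⟨r, hr, ?_⟩
  rwa [Algebra.algebraMap_eq_smul_one]

/-- A positive linear map decreases the perspective of an operator convex function. -/
theorem OperatorConvexOn.persp_map_le {f : ℝ → ℝ} (hf : OperatorConvexOn f)
    (hfc : ContinuousOn f (Set.Ici 0)) {Φ : (H →L[ℂ] H) →ₗ[ℂ] (H →L[ℂ] H)}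
    (hΦ : ∀ A, 0 ≤ A → 0 ≤ Φ A) (hΦ1 : Φ 1 = 1) {A B : H →L[ℂ] H} (hA : 0 ≤ A)
    (hB : IsStrictlyPositive B) :
    persp f (Φ A) (Φ B) ≤ Φ (persp f A B) := by
  have hR := isStrictlyPositive_map hΦ hΦ1 hB
  let Ψ : (H →L[ℂ] H) →ₗ[ℂ] (H →L[ℂ] H) :=
    LinearMap.mulLeftRight ℂ (opInvSqrt (Φ B), opInvSqrt (Φ B)) ∘ₗ Φ ∘ₗ
      LinearMap.mulLeftRight ℂ (opSqrt B, opSqrt B)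
  have hΨ : ∀ X, Ψ X = opInvSqrt (Φ B) * Φ (opSqrt B * X * opSqrt B) * opInvSqrt (Φ B) :=
    fun X => by simp [Ψ]
  have hΨpos : ∀ X, 0 ≤ X → 0 ≤ Ψ X := fun X hX => by
    rw [hΨ]
    exact (isSelfAdjoint_opInvSqrt _).conjugate_nonneg
      (hΦ _ ((isSelfAdjoint_opSqrt B).conjugate_nonneg hX))
  have hΨ1 : Ψ 1 = 1 := by
    rw [hΨ, mul_one, opSqrt_mul_opSqrt hB.nonneg]
    nth_rw 2 [← opSqrt_mul_opSqrt hR.nonneg]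
    rw [← mul_assoc, opInvSqrt_mul_opSqrt hR, one_mul, opSqrt_mul_opInvSqrt hR]
  have h := hf.cfc_map_le hfc hΨpos hΨ1 ((isSelfAdjoint_opInvSqrt B).conjugate_nonneg hA)
  have h' := (isSelfAdjoint_opSqrt (Φ B)).conjugate_le_conjugate h
  rwa [hΨ (cfc f _), opSqrt_conj_opInvSqrt_conj hR, hΨ, opSqrt_conj_opInvSqrt_conj hB] at h'

theorem persp_mono {f₁ f₂ : ℝ → ℝ} (hf₁ : ContinuousOn f₁ (Set.Ici 0))
    (hf₂ : ContinuousOn f₂ (Set.Ici 0)) (h : ∀ t, 0 ≤ t → f₁ t ≤ f₂ t) {A : H →L[ℂ] H}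
    (hA : 0 ≤ A) (B : H →L[ℂ] H) : persp f₁ A B ≤ persp f₂ A B := by
  have hspec := spectrum_subset_Ici ((isSelfAdjoint_opInvSqrt B).conjugate_nonneg hA)
  exact (isSelfAdjoint_opSqrt B).conjugate_le_conjugate
    (cfc_mono (fun x hx => h x (hspec hx)) (hf₁.mono hspec) (hf₂.mono hspec))

theorem persp_algebraMap_one (f : ℝ → ℝ) (t : ℝ) :
    persp f (algebraMap ℝ (H →L[ℂ] H) t) 1 = algebraMap ℝ (H →L[ℂ] H) (f t) := by
  have h1 : opSqrt (1 : H →L[ℂ] H) = 1 := by simp [opSqrt, cfc_apply_one]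
  have h2 : opInvSqrt (1 : H →L[ℂ] H) = 1 := by simp [opInvSqrt, cfc_apply_one]
  simp only [persp, h1, h2, one_mul, mul_one, cfc_algebraMap]

/-- For operator convex `f₁, f₂` on `[0, ∞)` with `f₁(0) ≤ 0` and `f₂(0) ≤ 0`, with
perspectives `g₁, g₂`: `f₁ ≤ f₂` pointwise if and only if `g₁(Φ(A), Φ(B)) ≤ Φ(g₂(A, B))`
for every Hilbert space, every unital positive linear map `Φ`, every positive `A` and
every strictly positive `B`. -/
theorem stmt_10 (f₁ f₂ : ℝ → ℝ)
    (hf₁_cont : ContinuousOn f₁ (Set.Ici (0 : ℝ))) (hf₂_cont : ContinuousOn f₂ (Set.Ici (0 : ℝ)))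
    (hf₁ : OperatorConvexOn f₁) (hf₂ : OperatorConvexOn f₂)
    (hf₁0 : f₁ 0 ≤ 0) (hf₂0 : f₂ 0 ≤ 0) :
    (∀ t : ℝ, 0 ≤ t → f₁ t ≤ f₂ t) ↔
      ∀ (K : Type) [NormedAddCommGroup K] [InnerProductSpace ℂ K] [CompleteSpace K],
        ∀ Φ : (K →L[ℂ] K) →ₗ[ℂ] (K →L[ℂ] K),
          (∀ A : K →L[ℂ] K, 0 ≤ A → 0 ≤ Φ A) → Φ 1 = 1 →
          ∀ A B : K →L[ℂ] K, 0 ≤ A → 0 ≤ B → IsUnit B →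
            persp f₁ (Φ A) (Φ B) ≤ Φ (persp f₂ A B) := by
  constructor
  · intro h K _ _ _ Φ hΦ hΦ1 A B hA hB hBu
    exact (hf₁.persp_map_le hf₁_cont hΦ hΦ1 hA ⟨hB, hBu⟩).trans
      (map_le_map_of_map_nonneg hΦ (persp_mono hf₁_cont hf₂_cont h hA B))
  · intro h t ht
    have ht' : 0 ≤ algebraMap ℝ (ℂ →L[ℂ] ℂ) t := by
      rw [Algebra.algebraMap_eq_smul_one]
      exact smul_nonneg ht zero_le_one
    have h' := h ℂ LinearMap.id (fun _ hA => hA) rfl _ 1 ht' zero_le_one isUnit_one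
    simp only [LinearMap.id_apply, persp_algebraMap_one] at h'
    have h1 := ((le_def _ _).mp h').re_inner_nonneg_left 1
    simpa [Algebra.algebraMap_eq_smul_one] using h1
end
end

section
/- Let f : [0,∞) → ℝ be operator convex with f(0) < 0, let h : [0,∞) → ℝ be operator concave with h(t) > 0 for all t ≥ 0, and let p = (p_1,…,p_n) and q = (q_1,…,q_n) be probability distributions (p_i, q_i ≥ 0, ∑p_i = ∑q_i = 1). Let L_1,…,L_n be positive operators on H and R_1,…,R_n strictly positive operators on H, and set L = ∑_{i=1}^n p_i L_i, R = ∑_{i=1}^n q_i R_i, assuming R is strictly positive. Then (fΔh)(L,R) ≤ ∑_{i=1}^n p_i · h(q_iR_i)^{1/2} f(h(q_iR_i)^{−1/2} L_i h(q_iR_i)^{−1/2}) h(q_iR_i)^{1/2} in the Loewner order. -/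
open scoped InnerProductSpace

noncomputable section

variable {H : Type} [NormedAddCommGroup H] [InnerProductSpace ℂ H] [CompleteSpace H]

/-- A continuous function `h : [0, ∞) → ℝ` is *operator concave* if `-h` is operator convex. -/
def OperatorConcaveOn (h : ℝ → ℝ) : Prop :=
  ∀ (K : Type) [NormedAddCommGroup K] [InnerProductSpace ℂ K] [CompleteSpace K],
    ∀ A B : K →L[ℂ] K, IsSelfAdjoint A → IsSelfAdjoint B →
      spectrum ℝ A ⊆ Set.Ici (0 : ℝ) → spectrum ℝ B ⊆ Set.Ici (0 : ℝ) →
      ∀ lam : ℝ, lam ∈ Set.Icc (0 : ℝ) 1 →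
        lam • cfc h A + (1 - lam) • cfc h B ≤ cfc h (lam • A + (1 - lam) • B)


/-- `(fΔh)(A, B) = h(B)^{1/2} f(h(B)^{-1/2} A h(B)^{-1/2}) h(B)^{1/2}`. -/
def fDelta (f h : ℝ → ℝ) {H : Type} [NormedAddCommGroup H] [InnerProductSpace ℂ H]
    [CompleteSpace H] (A B : H →L[ℂ] H) : H →L[ℂ] H :=
  opSqrt (cfc h B) * cfc f (opInvSqrt (cfc h B) * A * opInvSqrt (cfc h B)) * opSqrt (cfc h B)

section Jensen

open ContinuousLinearMap

variable {K₁ K₂ : Type} [NormedAddCommGroup K₁] [InnerProductSpace ℂ K₁] [CompleteSpace K₁]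
  [NormedAddCommGroup K₂] [InnerProductSpace ℂ K₂] [CompleteSpace K₂]

lemma spectrum_subset_Ici_of_nonneg {A : H →L[ℂ] H} (hA : 0 ≤ A) :
    spectrum ℝ A ⊆ Set.Ici (0 : ℝ) :=
  fun _ hx => spectrum_nonneg_of_nonneg hA hx

lemma aeval_comp_eq_comp_aeval {E F : Type} [NormedAddCommGroup E] [InnerProductSpace ℂ E]
    [NormedAddCommGroup F] [InnerProductSpace ℂ F] (P : Polynomial ℝ) {V : E →L[ℂ] F}
    {X : E →L[ℂ] E} {B : F →L[ℂ] F} (h : B ∘L V = V ∘L X) :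
    Polynomial.aeval B P ∘L V = V ∘L Polynomial.aeval X P := by
  have hpow : ∀ n : ℕ, (B ^ n) ∘L V = V ∘L (X ^ n) := by
    intro n
    induction n with
    | zero => ext; simp
    | succ n ih =>
      rw [pow_succ, pow_succ', mul_def, mul_def, comp_assoc, h, ← comp_assoc, ih, comp_assoc,
        ← mul_def, ← mul_def, ← pow_succ, ← pow_succ']
  induction P using Polynomial.induction_on' with
  | add P Q hP hQ => rw [map_add, map_add, add_comp, comp_add, hP, hQ]
  | monomial n a =>
    simp only [Polynomial.aeval_monomial, Algebra.algebraMap_eq_smul_one, smul_mul_assoc, one_mul]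
    rw [smul_comp, hpow]
    ext x
    simp

/-- The continuous functional calculus respects intertwining operators. -/
lemma cfc_comp_eq_comp_cfc_s11 {f : ℝ → ℝ} (hf : ContinuousOn f (Set.Ici 0)) {V : K₁ →L[ℂ] K₂}
    {X : K₁ →L[ℂ] K₁} {B : K₂ →L[ℂ] K₂} (hX : 0 ≤ X) (hB : 0 ≤ B) (h : B ∘L V = V ∘L X) :
    cfc f B ∘L V = V ∘L cfc f X := by
  have hX' := spectrum_subset_Ici_of_nonneg hX
  have hB' := spectrum_subset_Ici_of_nonneg hB
  have hXs : IsSelfAdjoint X := .of_nonneg hX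
  have hBs : IsSelfAdjoint B := .of_nonneg hB
  obtain ⟨M, hM⟩ := ((ContinuousFunctionalCalculus.isCompact_spectrum (R := ℝ) X).union
    (ContinuousFunctionalCalculus.isCompact_spectrum (R := ℝ) B)).bddAbove
  have key : ∀ ε > 0, ‖cfc f B ∘L V - V ∘L cfc f X‖ ≤ ε * (2 * ‖V‖) := by
    intro ε hε
    obtain ⟨P, hP⟩ := exists_polynomial_near_of_continuousOn 0 M f
      (hf.mono Set.Icc_subset_Ici_self) ε hε
    have near : ∀ {K : Type} [NormedAddCommGroup K] [InnerProductSpace ℂ K] [CompleteSpace K]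
        (A : K →L[ℂ] K), IsSelfAdjoint A → spectrum ℝ A ⊆ Set.Icc 0 M →
        ‖cfc f A - Polynomial.aeval A P‖ ≤ ε := by
      intro K _ _ _ A hA hs
      rw [← cfc_polynomial P A hA, ← cfc_sub f P.eval A
        (hf.mono (hs.trans Set.Icc_subset_Ici_self)) P.continuous.continuousOn]
      refine norm_cfc_le hε.le fun x hx => ?_
      rw [norm_sub_rev]
      exact (hP x (hs hx)).le
    have h1 := near X hXs fun x hx => ⟨hX' hx, hM (.inl hx)⟩
    have h2 := near B hBs fun x hx => ⟨hB' hx, hM (.inr hx)⟩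
    have h3 : cfc f B ∘L V - V ∘L cfc f X =
        (cfc f B - Polynomial.aeval B P) ∘L V - V ∘L (cfc f X - Polynomial.aeval X P) := by
      rw [sub_comp, comp_sub, aeval_comp_eq_comp_aeval P h]
      abel
    rw [h3]
    calc _ ≤ ‖cfc f B - Polynomial.aeval B P‖ * ‖V‖ + ‖V‖ * ‖cfc f X - Polynomial.aeval X P‖ :=
          (norm_sub_le _ _).trans (add_le_add (opNorm_comp_le _ _) (opNorm_comp_le _ _))
      _ ≤ ε * ‖V‖ + ‖V‖ * ε := by gcongr
      _ = ε * (2 * ‖V‖) := by ring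
  rw [← sub_eq_zero, ← norm_le_zero_iff]
  refine ge_of_tendsto (x := nhdsWithin (0 : ℝ) (Set.Ioi 0)) ?_
    (by filter_upwards [self_mem_nhdsWithin] with ε hε using key ε hε)
  refine tendsto_nhdsWithin_of_tendsto_nhds ?_
  exact (continuous_id.mul continuous_const).tendsto' (0 : ℝ) _ (zero_mul _)

lemma adjoint_comp_comp_nonneg (V : K₁ →L[ℂ] K₂) {A : K₂ →L[ℂ] K₂} (hA : 0 ≤ A) :
    0 ≤ adjoint V ∘L A ∘L V := by
  rw [nonneg_iff_isPositive] at *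
  exact hA.adjoint_conj V

lemma adjoint_comp_comp_mono (V : K₁ →L[ℂ] K₂) {A B : K₂ →L[ℂ] K₂} (h : A ≤ B) :
    adjoint V ∘L A ∘L V ≤ adjoint V ∘L B ∘L V := by
  have := adjoint_comp_comp_nonneg V (sub_nonneg.2 h)
  rwa [sub_comp, comp_sub, sub_nonneg] at this

/-- Jensen's operator inequality for compressions by an isometry. -/
lemma OperatorConvexOn.cfc_isometry_le {f : ℝ → ℝ} (hfc : ContinuousOn f (Set.Ici 0))
    (hf : OperatorConvexOn f) {V : K₁ →L[ℂ] K₂} (hV : adjoint V ∘L V = 1)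
    {D : K₂ →L[ℂ] K₂} (hD : 0 ≤ D) :
    cfc f (adjoint V ∘L D ∘L V) ≤ adjoint V ∘L cfc f D ∘L V := by
  set W : K₂ →L[ℂ] K₂ := (2 : ℝ) • (V ∘L adjoint V) - 1 with hW
  have hVx : ∀ x, adjoint V (V x) = x := fun x => by
    simpa using congrArg (fun T : K₁ →L[ℂ] K₁ => T x) hV
  have hWad : adjoint W = W := by
    rw [← isSelfAdjoint_iff']
    refine IsSelfAdjoint.sub (IsSelfAdjoint.smul (by simp [IsSelfAdjoint]) ?_) (.one _)
    rw [isSelfAdjoint_iff', adjoint_comp, adjoint_adjoint]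
  have hWV : W ∘L V = V := by
    ext x
    simp only [hW, comp_apply, sub_apply, smul_apply, hVx, one_apply_eq_self]
    module
  have hWW : W ∘L W = 1 := by
    ext x
    simp only [hW, comp_apply, sub_apply, smul_apply, hVx, one_apply_eq_self, map_sub,
      map_smul_of_tower]
    module
  have hWD : 0 ≤ W ∘L D ∘L W := by
    have := adjoint_comp_comp_nonneg W hD
    rwa [hWad] at this
  have hX : 0 ≤ adjoint V ∘L D ∘L V := adjoint_comp_comp_nonneg V hD
  set B : K₂ →L[ℂ] K₂ := (1 / 2 : ℝ) • D + (1 - 1 / 2 : ℝ) • (W ∘L D ∘L W) with hB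
  have hB0 : 0 ≤ B :=
    add_nonneg (smul_nonneg (by norm_num) hD) (smul_nonneg (by norm_num) hWD)
  have hBV : B ∘L V = V ∘L (adjoint V ∘L D ∘L V) := by
    ext x
    have hWVx : W (V x) = V x := congrArg (fun T : K₁ →L[ℂ] K₂ => T x) hWV
    simp only [hB, comp_apply, add_apply, smul_apply, hWVx]
    simp only [hW, comp_apply, sub_apply, smul_apply, one_apply_eq_self]
    module
  have hfB := cfc_comp_eq_comp_cfc_s11 hfc hX hB0 hBV
  have hfW : cfc f (W ∘L D ∘L W) = W ∘L cfc f D ∘L W := by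
    have := cfc_comp_eq_comp_cfc_s11 (V := W) hfc hD hWD (by
      rw [comp_assoc, comp_assoc, hWW]; rfl)
    calc _ = cfc f (W ∘L D ∘L W) ∘L (W ∘L W) := by rw [hWW]; rfl
      _ = W ∘L cfc f D ∘L W := by rw [← comp_assoc, this, comp_assoc]
  have hconv := hf K₂ D (W ∘L D ∘L W) (.of_nonneg hD) (.of_nonneg hWD)
    (spectrum_subset_Ici_of_nonneg hD) (spectrum_subset_Ici_of_nonneg hWD) (1 / 2)
    ⟨by norm_num, by norm_num⟩
  have h := adjoint_comp_comp_mono V hconv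
  have hVW : adjoint V ∘L W = adjoint V := by
    rw [← hWad, ← adjoint_comp, hWV]
  have hl : adjoint V ∘L cfc f B ∘L V = cfc f (adjoint V ∘L D ∘L V) := by
    rw [hfB, ← comp_assoc, hV]; rfl
  have hr : adjoint V ∘L ((1 / 2 : ℝ) • cfc f D + (1 - 1 / 2 : ℝ) • cfc f (W ∘L D ∘L W)) ∘L V =
      adjoint V ∘L cfc f D ∘L V := by
    have e : adjoint V ∘L (W ∘L cfc f D ∘L W) ∘L V = adjoint V ∘L cfc f D ∘L V := by
      rw [comp_assoc, comp_assoc, hWV, ← comp_assoc, hVW]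
    rw [hfW, add_comp, comp_add, smul_comp, smul_comp, comp_smul, comp_smul, e]
    module
  rwa [hl, hr] at h

/-- The inclusion of the `i`-th summand in a finite orthogonal power of `H`. -/
def piLpIncl {ι : Type} [Fintype ι] [DecidableEq ι] (i : ι) :
    H →L[ℂ] PiLp 2 (fun _ : ι => H) :=
  (PiLp.continuousLinearEquiv 2 ℂ (fun _ : ι => H)).symm.toContinuousLinearMap ∘L
    ContinuousLinearMap.single ℂ (fun _ : ι => H) i

lemma piLpIncl_apply {E : Type} [NormedAddCommGroup E] [InnerProductSpace ℂ E] {ι : Type}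
    [Fintype ι] [DecidableEq ι] (i j : ι) (x : E) :
    (piLpIncl i x : PiLp 2 (fun _ : ι => E)) j = if j = i then x else 0 := by
  simp [piLpIncl]

lemma adjoint_piLpIncl_apply {ι : Type} [Fintype ι] [DecidableEq ι] (i : ι)
    (y : PiLp 2 (fun _ : ι => H)) : adjoint (piLpIncl i) y = y i := by
  refine ext_inner_left ℂ fun x => ?_
  rw [adjoint_inner_right, PiLp.inner_apply]
  rw [Finset.sum_eq_single i (fun j _ hj => by simp [piLpIncl_apply, hj]) (by simp),
    piLpIncl_apply, if_pos rfl]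

lemma adjoint_piLpIncl_comp {ι : Type} [Fintype ι] [DecidableEq ι] (i j : ι) :
    adjoint (piLpIncl (H := H) i) ∘L piLpIncl j = if i = j then 1 else 0 := by
  ext x
  rw [comp_apply, adjoint_piLpIncl_apply, piLpIncl_apply]
  split_ifs <;> rfl

/-- Jensen's operator inequality. -/
lemma OperatorConvexOn.cfc_sum_le {f : ℝ → ℝ} (hfc : ContinuousOn f (Set.Ici 0))
    (hf : OperatorConvexOn f) {ι : Type} [Fintype ι] (C A : ι → H →L[ℂ] H)
    (hC : ∑ i, star (C i) * C i = 1) (hA : ∀ i, 0 ≤ A i) :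
    cfc f (∑ i, star (C i) * A i * C i) ≤ ∑ i, star (C i) * cfc f (A i) * C i := by
  classical
  let E : ι → H →L[ℂ] PiLp 2 (fun _ : ι => H) := piLpIncl
  let V : H →L[ℂ] PiLp 2 (fun _ : ι => H) := ∑ i, E i ∘L C i
  let D : PiLp 2 (fun _ : ι => H) →L[ℂ] PiLp 2 (fun _ : ι => H) :=
    ∑ i, E i ∘L A i ∘L adjoint (E i)
  have hEE : ∀ i j, adjoint (E i) ∘L E j = if i = j then 1 else 0 := adjoint_piLpIncl_comp
  have hEV : ∀ i, adjoint (E i) ∘L V = C i := by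
    intro i
    simp only [V, comp_finsetSum, ← comp_assoc, hEE]
    rw [Finset.sum_eq_single i (fun j _ hj => by simp [hj.symm]) (by simp)]
    simp only [if_true]; rfl
  have hVE : ∀ i, adjoint V ∘L E i = star (C i) := by
    intro i
    rw [star_eq_adjoint, ← hEV i, adjoint_comp, adjoint_adjoint]
  have hD : 0 ≤ D := Finset.sum_nonneg fun i _ => by
    have := adjoint_comp_comp_nonneg (adjoint (E i)) (hA i)
    rwa [adjoint_adjoint] at this
  have hDE : ∀ i, D ∘L E i = E i ∘L A i := by
    intro i
    simp only [D, finsetSum_comp, comp_assoc, hEE]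
    rw [Finset.sum_eq_single i (fun j _ hj => by simp [hj]) (by simp)]
    simp only [if_true]; rfl
  have hcomp : ∀ (G : PiLp 2 (fun _ : ι => H) →L[ℂ] PiLp 2 (fun _ : ι => H))
      (g : ι → H →L[ℂ] H), (∀ i, G ∘L E i = E i ∘L g i) →
      adjoint V ∘L G ∘L V = ∑ i, star (C i) * g i * C i := by
    intro G g hG
    have : G ∘L V = ∑ i, E i ∘L g i ∘L C i := by
      simp only [V, comp_finsetSum, ← comp_assoc, hG]
    rw [this, comp_finsetSum]
    refine Finset.sum_congr rfl fun i _ => ?_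
    rw [← comp_assoc, hVE, mul_assoc]; rfl
  have hVV : adjoint V ∘L V = 1 := by
    have := hcomp 1 (fun _ => 1) (fun i => rfl)
    simp only [mul_one, hC] at this
    exact this
  have := hf.cfc_isometry_le hfc hVV hD
  rwa [hcomp D A hDE, hcomp (cfc f D) (fun i => cfc f (A i))
    fun i => cfc_comp_eq_comp_cfc_s11 hfc (hA i) hD (hDE i)] at this

end Jensen

/-- A positive operator concave function on `[0, ∞)` is operator monotone. -/
lemma OperatorConcaveOn.cfc_mono_of_nonneg {h : ℝ → ℝ} (hhc : ContinuousOn h (Set.Ici 0))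
    (hh : OperatorConcaveOn h) (hpos : ∀ t : ℝ, 0 ≤ t → 0 < h t) {A B : H →L[ℂ] H}
    (hA : 0 ≤ A) (hAB : A ≤ B) : cfc h A ≤ cfc h B := by
  have hB : 0 ≤ B := hA.trans hAB
  have hB' := spectrum_subset_Ici_of_nonneg hB
  have hBs : IsSelfAdjoint B := .of_nonneg hB
  have hle : ∀ lam ∈ Set.Ioo (0 : ℝ) 1, lam • cfc h A ≤ cfc h (lam • B) := by
    intro lam hlam
    have h1 : 0 < 1 - lam := by linarith [hlam.2]
    set T : H →L[ℂ] H := (lam / (1 - lam)) • (B - A) with hT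
    have hT0 : 0 ≤ T := smul_nonneg (div_nonneg hlam.1.le h1.le) (sub_nonneg.2 hAB)
    have hc := hh H A T (.of_nonneg hA) (.of_nonneg hT0) (spectrum_subset_Ici_of_nonneg hA)
      (spectrum_subset_Ici_of_nonneg hT0) lam ⟨hlam.1.le, hlam.2.le⟩
    have e : lam • A + (1 - lam) • T = lam • B := by
      rw [hT, smul_smul, mul_div_cancel₀ _ h1.ne']
      module
    rw [e] at hc
    refine le_trans (le_add_of_nonneg_right ?_) hc
    exact smul_nonneg h1.le
      (cfc_nonneg fun x hx => (hpos x (spectrum_subset_Ici_of_nonneg hT0 hx)).le)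
  have hspec : ∀ lam ∈ Set.Ioc (0 : ℝ) 1,
      spectrum ℝ (lam • B) ⊆ Set.Icc 0 (‖B‖ * ‖(1 : H →L[ℂ] H)‖) := by
    intro lam hlam x hx
    refine ⟨spectrum_subset_Ici_of_nonneg (smul_nonneg hlam.1.le hB) hx, ?_⟩
    refine (le_abs_self x).trans ((spectrum.norm_le_norm_mul_of_mem hx).trans ?_)
    rw [norm_smul, Real.norm_of_nonneg hlam.1.le]
    gcongr
    exact mul_le_of_le_one_left (norm_nonneg B) hlam.2
  have hlim : Filter.Tendsto (fun lam : ℝ => cfc h (lam • B)) (nhdsWithin 1 (Set.Iio 1))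
      (nhds (cfc h B)) := by
    have hev : ∀ᶠ lam : ℝ in nhdsWithin 1 (Set.Iio 1), lam ∈ Set.Ioo (0 : ℝ) 1 :=
      Ioo_mem_nhdsLT one_pos
    refine Filter.Tendsto.cfc isCompact_Icc h ?_
      (hev.mono fun lam hlam => hspec lam ⟨hlam.1, hlam.2.le⟩)
      (.of_forall fun lam => (IsSelfAdjoint.all lam).smul hBs)
      (by simpa using hspec 1 ⟨one_pos, le_rfl⟩) hBs (hhc.mono Set.Icc_subset_Ici_self)
    refine tendsto_nhdsWithin_of_tendsto_nhds ?_
    exact ((continuous_id.smul continuous_const).tendsto' (1 : ℝ) _ (one_smul ℝ _))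
  have hlim' : Filter.Tendsto (fun lam : ℝ => lam • cfc h A) (nhdsWithin 1 (Set.Iio 1))
      (nhds (cfc h A)) := by
    refine tendsto_nhdsWithin_of_tendsto_nhds ?_
    exact ((continuous_id.smul continuous_const).tendsto' (1 : ℝ) _ (one_smul ℝ _))
  exact le_of_tendsto_of_tendsto hlim' hlim
    (Filter.mem_of_superset (Ioo_mem_nhdsLT one_pos) hle)

section Perspective

variable {S : H →L[ℂ] H}

lemma opSqrt_nonneg (S : H →L[ℂ] H) : 0 ≤ opSqrt S :=
  cfc_nonneg fun x _ => Real.sqrt_nonneg x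

lemma opInvSqrt_nonneg (S : H →L[ℂ] H) : 0 ≤ opInvSqrt S :=
  cfc_nonneg fun x _ => inv_nonneg.2 (Real.sqrt_nonneg x)

lemma opSqrt_mul_self (hS : 0 ≤ S) : opSqrt S * opSqrt S = S := by
  have hS' : IsSelfAdjoint S := .of_nonneg hS
  rw [opSqrt, ← cfc_mul _ _ S]
  conv_rhs => rw [← cfc_id ℝ S]
  exact cfc_congr fun x hx => Real.mul_self_sqrt (spectrum_subset_Ici_of_nonneg hS hx)

lemma continuousOn_inv_sqrt {s : Set ℝ} (hpos : ∀ x ∈ s, 0 < x) :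
    ContinuousOn (fun t : ℝ => (Real.sqrt t)⁻¹) s :=
  Real.continuous_sqrt.continuousOn.inv₀ fun x hx => (Real.sqrt_pos.2 (hpos x hx)).ne'

lemma opSqrt_mul_opInvSqrt_s11 (hS : IsSelfAdjoint S) (hpos : ∀ x ∈ spectrum ℝ S, 0 < x) :
    opSqrt S * opInvSqrt S = 1 := by
  have hc := continuousOn_inv_sqrt hpos
  rw [opSqrt, opInvSqrt, ← cfc_mul _ _ S, ← cfc_const_one ℝ S]
  exact cfc_congr fun x hx => mul_inv_cancel₀ (Real.sqrt_pos.2 (hpos x hx)).ne'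

lemma opInvSqrt_mul_opSqrt_s11 (hS : IsSelfAdjoint S) (hpos : ∀ x ∈ spectrum ℝ S, 0 < x) :
    opInvSqrt S * opSqrt S = 1 := by
  have hc := continuousOn_inv_sqrt hpos
  rw [opSqrt, opInvSqrt, ← cfc_mul _ _ S, ← cfc_const_one ℝ S]
  exact cfc_congr fun x hx => inv_mul_cancel₀ (Real.sqrt_pos.2 (hpos x hx)).ne'

lemma mul_mul_nonneg_of_isSelfAdjoint {A C : H →L[ℂ] H} (hA : 0 ≤ A) (hC : IsSelfAdjoint C) :
    0 ≤ C * A * C := by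
  simpa [hC.star_eq] using star_left_conjugate_nonneg hA C

lemma nonneg_of_spectrum_pos (hS : IsSelfAdjoint S) (hpos : ∀ x ∈ spectrum ℝ S, 0 < x) :
    0 ≤ S := by
  rw [← cfc_id ℝ S]
  exact cfc_nonneg fun x hx => (hpos x hx).le

/-- Joint convexity of the perspective of an operator convex function with `f 0 ≤ 0`, with a
second argument dominating the convex combination. -/
lemma OperatorConvexOn.persp_sum_le {f : ℝ → ℝ} (hfc : ContinuousOn f (Set.Ici 0))
    (hf : OperatorConvexOn f) (hf0 : f 0 ≤ 0) {ι : Type} [Fintype ι] (p : ι → ℝ)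
    (hp : ∀ i, 0 ≤ p i) (L S : ι → H →L[ℂ] H) (T : H →L[ℂ] H) (hL : ∀ i, 0 ≤ L i)
    (hS : ∀ i, IsSelfAdjoint (S i)) (hSpos : ∀ i, ∀ x ∈ spectrum ℝ (S i), 0 < x)
    (hT : IsSelfAdjoint T) (hTpos : ∀ x ∈ spectrum ℝ T, 0 < x) (hST : ∑ i, p i • S i ≤ T) :
    persp f (∑ i, p i • L i) T ≤ ∑ i, p i • persp f (L i) (S i) := by
  have hS0 := fun i => nonneg_of_spectrum_pos (hS i) (hSpos i)
  have hT0 := nonneg_of_spectrum_pos hT hTpos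
  have hssa : ∀ A : H →L[ℂ] H, IsSelfAdjoint (opSqrt A) := fun A => .of_nonneg (opSqrt_nonneg A)
  have htsa : ∀ A : H →L[ℂ] H, IsSelfAdjoint (opInvSqrt A) :=
    fun A => .of_nonneg (opInvSqrt_nonneg A)
  set s := opSqrt T with hs
  set t := opInvSqrt T with ht
  have hst : s * t = 1 := opSqrt_mul_opInvSqrt_s11 hT hTpos
  have hts : t * s = 1 := opInvSqrt_mul_opSqrt_s11 hT hTpos
  set G := T - ∑ i, p i • S i with hG
  have hG0 : 0 ≤ G := sub_nonneg.2 hST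
  let C : Option ι → H →L[ℂ] H := fun o =>
    o.elim (opSqrt G * t) fun i => Real.sqrt (p i) • (opSqrt (S i) * t)
  let A : Option ι → H →L[ℂ] H := fun o =>
    o.elim 0 fun i => opInvSqrt (S i) * L i * opInvSqrt (S i)
  have hA : ∀ o, 0 ≤ A o := by
    rintro (_ | i)
    · exact le_rfl
    · exact mul_mul_nonneg_of_isSelfAdjoint (hL i) (htsa _)
  have hCC : ∀ (i : ι) (X : H →L[ℂ] H), star (C (some i)) * X * C (some i) =
      t * (p i • (opSqrt (S i) * X * opSqrt (S i))) * t := by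
    intro i X
    simp only [C, Option.elim, star_smul, star_mul, (hssa _).star_eq, ht, (htsa _).star_eq,
      star_trivial, smul_mul_assoc, mul_smul_comm, smul_smul, Real.mul_self_sqrt (hp i), mul_assoc]
  have hC0 : ∀ X : H →L[ℂ] H, star (C none) * X * C none =
      t * (opSqrt G * X * opSqrt G) * t := by
    intro X
    simp only [C, Option.elim, star_mul, (hssa _).star_eq, ht, (htsa _).star_eq, mul_assoc]
  have hC : ∑ o, star (C o) * C o = 1 := by
    have h1 : ∑ o, star (C o) * 1 * C o = t * T * t := by
      rw [Fintype.sum_option, hC0]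
      simp only [hCC, mul_one (opSqrt _), opSqrt_mul_self hG0, opSqrt_mul_self (hS0 _)]
      rw [← Finset.sum_mul, ← Finset.mul_sum, ← add_mul, ← mul_add, hG, sub_add_cancel]
    simp only [mul_one] at h1
    rw [h1, ← opSqrt_mul_self hT0, ← hs, ← mul_assoc, hts, one_mul, hst]
  have hJ := hf.cfc_sum_le hfc C A hC hA
  have hsum : ∑ o, star (C o) * A o * C o = t * (∑ i, p i • L i) * t := by
    rw [Fintype.sum_option, hC0]
    have : ∀ i, opSqrt (S i) * A (some i) * opSqrt (S i) = L i := by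
      intro i
      calc _ = (opSqrt (S i) * opInvSqrt (S i)) * L i * (opInvSqrt (S i) * opSqrt (S i)) := by
            simp only [A, Option.elim, mul_assoc]
        _ = L i := by
            rw [opSqrt_mul_opInvSqrt_s11 (hS i) (hSpos i), opInvSqrt_mul_opSqrt_s11 (hS i) (hSpos i),
              one_mul, mul_one]
    simp only [hCC, this]
    rw [← Finset.sum_mul, ← Finset.mul_sum]
    simp [A]
  have hrhs : ∑ o, star (C o) * cfc f (A o) * C o ≤
      t * (∑ i, p i • persp f (L i) (S i)) * t := by
    rw [Fintype.sum_option]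
    simp only [hCC]
    rw [← Finset.sum_mul, ← Finset.mul_sum]
    refine add_le_of_nonpos_left ?_
    have hA0 : cfc f (A none) = f 0 • (1 : H →L[ℂ] H) := by
      simp [A, Algebra.algebraMap_eq_smul_one]
    rw [hA0, mul_smul_comm, mul_one, smul_mul_assoc]
    exact smul_nonpos_of_nonpos_of_nonneg hf0 (star_mul_self_nonneg _)
  rw [hsum] at hJ
  have h := star_left_conjugate_le_conjugate (hJ.trans hrhs) s
  rw [(hssa T).star_eq] at h
  refine h.trans_eq ?_
  calc s * (t * (∑ i, p i • persp f (L i) (S i)) * t) * s =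
        (s * t) * (∑ i, p i • persp f (L i) (S i)) * (t * s) := by simp only [mul_assoc]
    _ = _ := by rw [hst, hts, one_mul, mul_one]

end Perspective

/-- For probability distributions `p, q` and `L = ∑ i, p i • L i`, `R = ∑ i, q i • R i`:
`(fΔh)(L, R) ≤ ∑ i, p i • (fΔh)(L i, q i • R i)`, which is the generalized perspective
functional `(f∇h)(L̃, R̃, p, q)`. -/
theorem stmt_11 (f h : ℝ → ℝ)
    (hf_cont : ContinuousOn f (Set.Ici (0 : ℝ))) (hh_cont : ContinuousOn h (Set.Ici (0 : ℝ)))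
    (hf : OperatorConvexOn f) (hf0 : f 0 < 0)
    (hh : OperatorConcaveOn h) (hhpos : ∀ t : ℝ, 0 ≤ t → 0 < h t)
    (n : ℕ) (p q : Fin n → ℝ) (hp : ∀ i, 0 ≤ p i) (hq : ∀ i, 0 ≤ q i)
    (hp1 : ∑ i, p i = 1) (hq1 : ∑ i, q i = 1)
    (L R : Fin n → H →L[ℂ] H)
    (hL : ∀ i, 0 ≤ L i) (hR : ∀ i, 0 ≤ R i ∧ IsUnit (R i))
    (hRsum : IsUnit (∑ i, q i • R i)) :
    fDelta f h (∑ i, p i • L i) (∑ i, q i • R i) ≤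
      ∑ i, p i • fDelta f h (L i) (q i • R i) := by
  have hRi : ∀ i, 0 ≤ q i • R i := fun i => smul_nonneg (hq i) (hR i).1
  have hRs : 0 ≤ ∑ i, q i • R i := Finset.sum_nonneg fun i _ => hRi i
  have hspec : ∀ A : H →L[ℂ] H, 0 ≤ A → ∀ x ∈ spectrum ℝ (cfc h A), 0 < x := by
    intro A hA x hx
    have hA' := spectrum_subset_Ici_of_nonneg hA
    rw [cfc_map_spectrum h A (.of_nonneg hA) (hh_cont.mono hA')] at hx
    obtain ⟨y, hy, rfl⟩ := hx
    exact hhpos y (hA' hy)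
  refine hf.persp_sum_le hf_cont hf0.le p hp L (fun i => cfc h (q i • R i)) _ hL
    (fun i => cfc_predicate h _) (fun i => hspec _ (hRi i)) (cfc_predicate h _) (hspec _ hRs) ?_
  calc ∑ i, p i • cfc h (q i • R i) ≤ ∑ i, p i • cfc h (∑ i, q i • R i) :=
        Finset.sum_le_sum fun i _ => smul_le_smul_of_nonneg_left
          (hh.cfc_mono_of_nonneg hh_cont hhpos (hRi i)
            (Finset.single_le_sum (f := fun i => q i • R i) (fun j _ => hRi j)
              (Finset.mem_univ i))) (hp i)
    _ = cfc h (∑ i, q i • R i) := by rw [← Finset.sum_smul, hp1, one_smul]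
end
end

section
/- Let f : [0,∞) → ℝ be operator convex, let Φ_1,…,Φ_n be positive linear maps from bounded operators on H to bounded operators on K with ∑_{i=1}^n Φ_i(I) = I, and let A_1,…,A_n be positive operators on H. Let S_1 ⊆ {1,…,n} be nonempty with D_1 = ∑_{i∈S_1} Φ_i(I) invertible. Then ∑_{i=1}^n Φ_i(f(A_i)) − f(∑_{i=1}^n Φ_i(A_i)) ≥ ∑_{i∈S_1} Φ_i(f(A_i)) − D_1^{1/2} f(D_1^{−1/2} (∑_{i∈S_1} Φ_i(A_i)) D_1^{−1/2}) D_1^{1/2} ≥ 0 in the Loewner order. -/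
open scoped InnerProductSpace

noncomputable section

variable {H : Type} [NormedAddCommGroup H] [InnerProductSpace ℂ H] [CompleteSpace H]

open ContinuousLinearMap in
/-- The continuous functional calculus respects intertwiners of positive operators. -/
theorem cfc_intertwine {E F : Type} [NormedAddCommGroup E] [InnerProductSpace ℂ E]
    [CompleteSpace E] [NormedAddCommGroup F] [InnerProductSpace ℂ F] [CompleteSpace F]
    {f : ℝ → ℝ} (hf : ContinuousOn f (Set.Ici 0)) {X : E →L[ℂ] E} {C : F →L[ℂ] F}
    (hX : 0 ≤ X) (hC : 0 ≤ C) (W : E →L[ℂ] F) (hW : W ∘L X = C ∘L W) :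
    W ∘L cfc f X = cfc f C ∘L W := by
  set M := max ‖X‖ ‖C‖
  have hspec {G : Type} [NormedAddCommGroup G] [InnerProductSpace ℂ G] [CompleteSpace G]
      {Y : G →L[ℂ] G} (hY : 0 ≤ Y) (hM : ‖Y‖ ≤ M) : spectrum ℝ Y ⊆ Set.Icc 0 M := fun t ht =>
    ⟨spectrum_nonneg_of_nonneg hY ht, (le_abs_self t).trans <|
      (spectrum.norm_le_norm_mul_of_mem ht).trans <|
        (mul_le_of_le_one_right (norm_nonneg Y) norm_id_le).trans hM⟩
  have hsX := hspec hX (le_max_left _ _)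
  have hsC := hspec hC (le_max_right _ _)
  have hfM : ContinuousOn f (Set.Icc 0 M) := hf.mono Set.Icc_subset_Ici_self
  have hXs := IsSelfAdjoint.of_nonneg hX
  have hCs := IsSelfAdjoint.of_nonneg hC
  have hpoly (p : Polynomial ℝ) :
      W ∘L Polynomial.aeval X p = Polynomial.aeval C p ∘L W := by
    induction p using Polynomial.induction_on' with
    | add p q hp hq => simp [comp_add, add_comp, hp, hq]
    | monomial k r =>
      have hpow : W ∘L (X ^ k) = (C ^ k) ∘L W := by
        induction k with
        | zero => ext x; simp
        | succ k ih =>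
          rw [pow_succ, pow_succ, mul_def, mul_def, ← comp_assoc, ih, comp_assoc, hW, comp_assoc]
      simp only [Polynomial.aeval_monomial, Algebra.algebraMap_eq_smul_one, smul_mul_assoc,
        one_mul]
      ext x
      have := congr($hpow x)
      simp_all
  have key (ε : ℝ) (hε : 0 < ε) :
      ‖W ∘L cfc f X - cfc f C ∘L W‖ ≤ ε * (2 * ‖W‖) := by
    obtain ⟨p, hp⟩ := exists_polynomial_near_of_continuousOn 0 M f hfM ε hε
    have happrox {G : Type} [NormedAddCommGroup G] [InnerProductSpace ℂ G] [CompleteSpace G]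
        {Y : G →L[ℂ] G} (hY : IsSelfAdjoint Y) (hs : spectrum ℝ Y ⊆ Set.Icc 0 M) :
        ‖cfc f Y - Polynomial.aeval Y p‖ ≤ ε := by
      rw [← cfc_polynomial p Y hY, ← cfc_sub f p.eval Y (hfM.mono hs) (by fun_prop)]
      refine norm_cfc_le hε.le fun x hx => ?_
      rw [Real.norm_eq_abs, abs_sub_comm]
      exact (hp x (hs hx)).le
    calc ‖W ∘L cfc f X - cfc f C ∘L W‖
        = ‖W ∘L (cfc f X - Polynomial.aeval X p) - (cfc f C - Polynomial.aeval C p) ∘L W‖ := by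
          rw [comp_sub, sub_comp, hpoly]; congr 1; abel
      _ ≤ ‖W‖ * ε + ε * ‖W‖ := by
          refine (norm_sub_le _ _).trans (add_le_add ?_ ?_)
          · exact (opNorm_comp_le _ _).trans (by gcongr; exact happrox hXs hsX)
          · exact (opNorm_comp_le _ _).trans (by gcongr; exact happrox hCs hsC)
      _ = ε * (2 * ‖W‖) := by ring
  rw [← sub_eq_zero, ← norm_le_zero_iff]
  refine le_of_forall_pos_le_add fun δ hδ => ?_
  have hpos : 0 < 2 * ‖W‖ + 1 := by positivity
  have := key (δ / (2 * ‖W‖ + 1)) (by positivity)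
  refine this.trans ?_
  rw [zero_add, div_mul_eq_mul_div, div_le_iff₀ hpos]
  nlinarith

open ContinuousLinearMap in
/-- Jensen's operator inequality for compression by an isometry. -/
theorem cfc_isometry_conj_le {E F : Type} [NormedAddCommGroup E] [InnerProductSpace ℂ E]
    [CompleteSpace E] [NormedAddCommGroup F] [InnerProductSpace ℂ F] [CompleteSpace F]
    {f : ℝ → ℝ} (hf_cont : ContinuousOn f (Set.Ici 0)) (hf : OperatorConvexOn f)
    {D : F →L[ℂ] F} (hD : 0 ≤ D) (V : E →L[ℂ] F) (hV : adjoint V ∘L V = .id ℂ E) :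
    cfc f (adjoint V ∘L D ∘L V) ≤ adjoint V ∘L cfc f D ∘L V := by
  have hV' (x : E) : adjoint V (V x) = x := congr($hV x)
  set R : F →L[ℂ] F := 2 • (V ∘L adjoint V) - 1 with hR
  have hRs : star R = R := by
    rw [star_eq_adjoint, hR]
    simp only [two_smul, map_sub, map_add, adjoint_comp, adjoint_adjoint]
    congr 1
    exact star_one (F →L[ℂ] F)
  have hRR : R * R = 1 := by
    ext x
    simp [hR, two_smul, hV']
  have hRV : R ∘L V = V := by
    ext x
    simp [hR, two_smul, hV']
  have hVR : adjoint V ∘L R = adjoint V := by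
    ext x
    simp [hR, two_smul, hV']
  have hRDR : 0 ≤ R * D * R := by
    simpa only [hRs] using star_left_conjugate_nonneg hD R
  have hfRDR : cfc f (R * D * R) = R * cfc f D * R := by
    have := cfc_intertwine hf_cont hD hRDR R (by
      change R * D = R * D * R * R
      rw [mul_assoc _ R R, hRR, mul_one])
    change R * cfc f D = cfc f (R * D * R) * R at this
    rw [this, mul_assoc _ R R, hRR, mul_one]
  have hhalf : (0 : ℝ) ≤ 1 / 2 := by norm_num
  have hhalf' : (0 : ℝ) ≤ 1 - 1 / 2 := by norm_num
  set C := (1 / 2 : ℝ) • D + (1 - 1 / 2 : ℝ) • (R * D * R) with hC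
  have hCpos : 0 ≤ C := add_nonneg (smul_nonneg hhalf hD) (smul_nonneg hhalf' hRDR)
  have hX : 0 ≤ adjoint V ∘L D ∘L V := by
    rw [nonneg_iff_isPositive] at hD ⊢
    exact hD.adjoint_conj V
  have hconv := hf F D (R * D * R) (.of_nonneg hD) (.of_nonneg hRDR)
    (fun t ht => spectrum_nonneg_of_nonneg hD ht)
    (fun t ht => spectrum_nonneg_of_nonneg hRDR ht) (1 / 2) ⟨hhalf, by norm_num⟩
  rw [← hC, hfRDR] at hconv
  have hint : V ∘L (adjoint V ∘L D ∘L V) = C ∘L V := by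
    ext x
    have h1 : R (V x) = V x := congr($hRV x)
    change _ = (1 / 2 : ℝ) • D (V x) + (1 - 1 / 2 : ℝ) • R (D (R (V x)))
    have h2 : R (D (V x)) = (2 : ℝ) • V (adjoint V (D (V x))) - D (V x) := by
      simp [hR, two_smul]
    rw [h1, h2]
    simp only [comp_apply]
    module
  have hfint := cfc_intertwine hf_cont hX hCpos V hint
  have hle := (le_def _ _).1 hconv |>.adjoint_conj V
  rw [le_def]
  convert hle using 1
  ext x
  have h1 : R (V x) = V x := congr($hRV x)
  have h2 (y : F) : adjoint V (R y) = adjoint V y := congr($hVR y)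
  have h3 : V (cfc f (adjoint V ∘L D ∘L V) x) = cfc f C (V x) := congr($hfint x)
  change _ = adjoint V ((1 / 2 : ℝ) • cfc f D (V x) +
    (1 - 1 / 2 : ℝ) • R (cfc f D (R (V x))) - cfc f C (V x))
  simp only [comp_apply, sub_apply, h1, map_sub, map_add, ← h3, hV', map_smul_of_tower, h2]
  module

open ContinuousLinearMap in
/-- Jensen's operator inequality for finitely supported positive-operator-valued weights. -/
theorem cfc_sum_smul_le {E ι : Type} [NormedAddCommGroup E] [InnerProductSpace ℂ E]
    [CompleteSpace E] [Fintype ι]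
    {f : ℝ → ℝ} (hf_cont : ContinuousOn f (Set.Ici 0)) (hf : OperatorConvexOn f)
    {t : ι → ℝ} (ht : ∀ j, 0 ≤ t j) {S : ι → E →L[ℂ] E} (hS : ∀ j, 0 ≤ S j)
    (hsum : ∑ j, S j = 1) :
    cfc f (∑ j, t j • S j) ≤ ∑ j, f (t j) • S j := by
  let e := PiLp.continuousLinearEquiv 2 ℂ (fun _ : ι => E)
  let V : E →L[ℂ] PiLp 2 (fun _ : ι => E) :=
    e.symm.toContinuousLinearMap ∘L ContinuousLinearMap.pi fun j => CFC.sqrt (S j)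
  let diag (c : ι → ℝ) : PiLp 2 (fun _ : ι => E) →L[ℂ] PiLp 2 (fun _ : ι => E) :=
    e.symm.toContinuousLinearMap ∘L
      ContinuousLinearMap.pi fun j => c j • PiLp.proj 2 (fun _ : ι => E) j
  have hVapp (x : E) (j : ι) : V x j = CFC.sqrt (S j) x := rfl
  have hdapp (c : ι → ℝ) (y : PiLp 2 (fun _ : ι => E)) (j : ι) : diag c y j = c j • y j := rfl
  have hcomp (c : ι → ℝ) : adjoint V ∘L diag c ∘L V = ∑ j, c j • S j := by
    ext x
    refine ext_inner_right ℂ fun y => ?_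
    rw [comp_apply, adjoint_inner_left, PiLp.inner_apply, sum_apply, sum_inner]
    refine Finset.sum_congr rfl fun j _ => ?_
    have hsa : adjoint (CFC.sqrt (S j)) = CFC.sqrt (S j) :=
      (IsSelfAdjoint.of_nonneg (CFC.sqrt_nonneg (S j))).adjoint_eq
    have hsq : CFC.sqrt (S j) (CFC.sqrt (S j) x) = S j x :=
      congr($(CFC.sqrt_mul_sqrt_self (S j) (hS j)) x)
    rw [comp_apply, hdapp, hVapp, hVapp, ← adjoint_inner_left, hsa, map_smul_of_tower, hsq]
    rfl
  have hdiag (c : ι → ℝ) (hc : ∀ j, 0 ≤ c j) : 0 ≤ diag c := by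
    rw [nonneg_iff_isPositive, isPositive_iff_complex]
    intro x
    have : ⟪diag c x, x⟫_ℂ = ((∑ j, c j * ‖x j‖ ^ 2 : ℝ) : ℂ) := by
      rw [PiLp.inner_apply]
      push_cast
      refine Finset.sum_congr rfl fun j _ => ?_
      rw [hdapp, ← Complex.coe_smul, inner_smul_left, Complex.conj_ofReal,
        inner_self_eq_norm_sq_to_K]
      rfl
    rw [this]
    exact ⟨rfl, Finset.sum_nonneg fun j _ => mul_nonneg (hc j) (sq_nonneg _)⟩
  have hV : adjoint V ∘L V = .id ℂ E := by
    have h1 : diag 1 = .id ℂ _ := by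
      ext y j
      simp [hdapp]
    have := hcomp 1
    simp only [h1, id_comp, Pi.one_apply, one_smul, hsum] at this
    exact this
  have hcfc : cfc f (diag t) = diag (f ∘ t) := by
    ext y j
    have htj : 0 ≤ algebraMap ℝ (E →L[ℂ] E) (t j) := algebraMap_nonneg _ (ht j)
    have := cfc_intertwine hf_cont (hdiag t ht) htj (PiLp.proj 2 (fun _ : ι => E) j) (by
      ext y
      rw [Algebra.algebraMap_eq_smul_one]
      rfl)
    rw [cfc_algebraMap, Algebra.algebraMap_eq_smul_one] at this
    exact congr($this y)
  have := cfc_isometry_conj_le hf_cont hf (hdiag t ht) V hV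
  rwa [hcfc, hcomp, hcomp] at this

/-- The pair `(X, Y)` of mass `T` is, up to errors `ε • T`, of the form
`(∑ j, t j • S j, ∑ j, f (t j) • S j)` with finitely many positive `S j` of total mass `T`
and nonnegative `t j`. -/
def JensenApprox {E : Type} [NormedAddCommGroup E] [InnerProductSpace ℂ E] [CompleteSpace E]
    (f : ℝ → ℝ) (T X Y : E →L[ℂ] E) : Prop :=
  ∀ ε : ℝ, 0 < ε → ∃ (ι : Type) (_ : Fintype ι) (t : ι → ℝ) (S : ι → E →L[ℂ] E),
    (∀ j, 0 ≤ t j) ∧ (∀ j, 0 ≤ S j) ∧ ∑ j, S j = T ∧ ∑ j, t j • S j = X ∧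
      ∑ j, f (t j) • S j ≤ Y + ε • T

namespace JensenApprox

variable {E F : Type} [NormedAddCommGroup E] [InnerProductSpace ℂ E] [CompleteSpace E]
  [NormedAddCommGroup F] [InnerProductSpace ℂ F] [CompleteSpace F] {f : ℝ → ℝ}

theorem map {T X Y : E →L[ℂ] E} (h : JensenApprox f T X Y)
    (Φ : (E →L[ℂ] E) →ₗ[ℂ] (F →L[ℂ] F)) (hΦ : ∀ A, 0 ≤ A → 0 ≤ Φ A) :
    JensenApprox f (Φ T) (Φ X) (Φ Y) := by
  intro ε hε
  obtain ⟨ι, _, t, S, ht, hS, rfl, rfl, hle⟩ := h ε hε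
  refine ⟨ι, inferInstance, t, fun j => Φ (S j), ht, fun j => hΦ _ (hS j), (map_sum Φ _ _).symm,
    ?_, ?_⟩
  · simp only [map_sum, LinearMap.map_smul_of_tower]
  · have := hΦ _ (sub_nonneg.2 hle)
    rw [map_sub, sub_nonneg, map_add] at this
    simpa only [map_sum, LinearMap.map_smul_of_tower] using this

theorem zero : JensenApprox f (0 : E →L[ℂ] E) 0 0 := fun _ _ =>
  ⟨Empty, inferInstance, Empty.elim, Empty.elim, by simp, by simp, by simp, by simp, by simp⟩

theorem add {T X Y T' X' Y' : E →L[ℂ] E} (h : JensenApprox f T X Y)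
    (h' : JensenApprox f T' X' Y') : JensenApprox f (T + T') (X + X') (Y + Y') := by
  intro ε hε
  obtain ⟨ι, _, t, S, ht, hS, rfl, rfl, hle⟩ := h ε hε
  obtain ⟨ι', _, t', S', ht', hS', rfl, rfl, hle'⟩ := h' ε hε
  refine ⟨ι ⊕ ι', inferInstance, Sum.elim t t', Sum.elim S S', by simp [ht, ht'],
    by simp [hS, hS'], by simp, by simp, ?_⟩
  simp only [Fintype.sum_sum_type, Sum.elim_inl, Sum.elim_inr]
  refine (add_le_add hle hle').trans_eq ?_
  rw [smul_add]
  abel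

theorem sum {κ : Type*} (s : Finset κ) {T X Y : κ → E →L[ℂ] E}
    (h : ∀ i ∈ s, JensenApprox f (T i) (X i) (Y i)) :
    JensenApprox f (∑ i ∈ s, T i) (∑ i ∈ s, X i) (∑ i ∈ s, Y i) := by
  classical
  induction s using Finset.induction_on with
  | empty => simpa using zero
  | insert i s hi ih =>
    simp only [Finset.sum_insert hi]
    exact (h i (Finset.mem_insert_self i s)).add
      (ih fun j hj => h j (Finset.mem_insert_of_mem hj))

theorem cfc_le {X Y : E →L[ℂ] E} (h : JensenApprox f 1 X Y)
    (hf_cont : ContinuousOn f (Set.Ici 0)) (hf : OperatorConvexOn f) : cfc f X ≤ Y := by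
  have key (ε : ℝ) (hε : 0 < ε) : cfc f X ≤ Y + ε • 1 := by
    obtain ⟨ι, _, t, S, ht, hS, hsum, rfl, hle⟩ := h ε hε
    exact (cfc_sum_smul_le hf_cont hf ht hS hsum).trans hle
  have hlim : Filter.Tendsto (fun ε : ℝ => Y + ε • (1 : E →L[ℂ] E))
      (nhdsWithin 0 (Set.Ioi 0)) (nhds Y) := by
    have : Continuous fun ε : ℝ => Y + ε • (1 : E →L[ℂ] E) := by fun_prop
    simpa using (this.tendsto 0).mono_left nhdsWithin_le_nhds
  exact ge_of_tendsto hlim (Filter.eventually_of_mem self_mem_nhdsWithin key)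

theorem of_cfc (hf_cont : ContinuousOn f (Set.Ici 0)) {A : E →L[ℂ] E} (hA : 0 ≤ A) :
    JensenApprox f 1 A (cfc f A) := by
  intro ε hε
  set M := ‖A‖ + 1
  have hM : 0 < M := by positivity
  have hAs : IsSelfAdjoint A := .of_nonneg hA
  have hspec (t : ℝ) (ht : t ∈ spectrum ℝ A) : t / M ∈ unitInterval := by
    have h0 : 0 ≤ t := spectrum_nonneg_of_nonneg hA ht
    have h1 : t ≤ ‖A‖ * 1 := (le_abs_self t).trans <|
      (spectrum.norm_le_norm_mul_of_mem ht).trans <| by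
        gcongr
        exact ContinuousLinearMap.norm_id_le
    exact ⟨by positivity, (div_le_one hM).2 (by simp only [M]; linarith)⟩
  have hfA : ContinuousOn f (spectrum ℝ A) :=
    hf_cont.mono fun t ht => spectrum_nonneg_of_nonneg hA ht
  let g : C(unitInterval, ℝ) := ⟨fun s => f (M * s),
    hf_cont.comp_continuous (by fun_prop) fun s => mul_nonneg hM.le s.2.1⟩
  obtain ⟨n, hn, hn0⟩ := (((Metric.tendsto_nhds.1 (bernsteinApproximation_uniform g)) ε hε).and
    (Filter.eventually_ne_atTop 0)).exists
  let p (k : Fin (n + 1)) (t : ℝ) : ℝ := (bernsteinPolynomial ℝ n k).eval (t / M)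
  have hpc (k : Fin (n + 1)) : Continuous (p k) := by
    simp only [p]
    fun_prop
  have hpb (k : Fin (n + 1)) (t : ℝ) (ht : t ∈ spectrum ℝ A) :
      p k t = bernstein n k ⟨t / M, hspec t ht⟩ := rfl
  have hlin (c : Fin (n + 1) → ℝ) :
      ∑ k, c k • cfc (p k) A = cfc (fun t => ∑ k, c k * p k t) A := by
    rw [← Finset.sum_fn Finset.univ fun k t => c k * p k t,
      cfc_sum (fun k t => c k * p k t) A Finset.univ fun k _ => by fun_prop]
    exact Finset.sum_congr rfl fun k _ => (cfc_const_mul (c k) (p k) A).symm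
  refine ⟨Fin (n + 1), inferInstance, fun k => M * (k / n), fun k => cfc (p k) A,
    fun k => by positivity, fun k => cfc_nonneg fun t ht => ?_, ?_, ?_, ?_⟩
  · rw [hpb k t ht]
    exact bernstein_nonneg
  · have := hlin 1
    simp only [Pi.one_apply, one_smul, one_mul] at this
    rw [this, ← cfc_const_one ℝ A]
    refine cfc_congr fun t ht => ?_
    simp only [hpb _ t ht]
    exact bernstein.probability n _
  · rw [hlin]
    conv_rhs => rw [← cfc_id' ℝ A]
    refine cfc_congr fun t _ => ?_
    have h := congr(Polynomial.eval (t / M) $(bernsteinPolynomial.sum_smul ℝ n))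
    rw [Polynomial.eval_finsetSum, ← Fin.sum_univ_eq_sum_range
      (fun k => Polynomial.eval (t / M) (k • bernsteinPolynomial ℝ n k))] at h
    simp only [nsmul_eq_mul, Polynomial.eval_mul, Polynomial.eval_natCast, Polynomial.eval_X] at h
    calc ∑ k : Fin (n + 1), M * (k / n) * p k t
        = M / n * ∑ k : Fin (n + 1), (k : ℝ) * p k t := by
          rw [Finset.mul_sum]
          exact Finset.sum_congr rfl fun k _ => by ring
      _ = t := by
          rw [h]
          field_simp
  · have hε1 : ε • (1 : E →L[ℂ] E) = cfc (fun _ : ℝ => ε) A := by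
      rw [cfc_const ε A, Algebra.algebraMap_eq_smul_one]
    rw [hlin, hε1, ← cfc_add A f (fun _ => ε) hfA (by fun_prop)]
    refine cfc_mono (fun t ht => ?_) (by fun_prop) (hfA.add (by fun_prop))
    have h := (ContinuousMap.dist_apply_le_dist ⟨t / M, hspec t ht⟩).trans hn.le
    rw [bernsteinApproximation.apply, Real.dist_eq] at h
    have hg : g ⟨t / M, hspec t ht⟩ = f t := by
      simp only [g, ContinuousMap.coe_mk]
      congr 1
      field_simp
    rw [hg] at h
    have := (abs_le.1 h).2
    have heq : ∑ k : Fin (n + 1), f (M * (k / n)) * p k t =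
        ∑ k : Fin (n + 1), bernstein n k ⟨t / M, hspec t ht⟩ • g (bernstein.z k) :=
      Finset.sum_congr rfl fun k _ => mul_comm _ _
    rw [heq]
    linarith

end JensenApprox

/-- Two-sided multiplication `A ↦ c * A * c`, as a linear map. -/
def conjLinearMap {E : Type} [NormedAddCommGroup E] [InnerProductSpace ℂ E] (c : E →L[ℂ] E) :
    (E →L[ℂ] E) →ₗ[ℂ] (E →L[ℂ] E) :=
  LinearMap.mulRight ℂ c ∘ₗ LinearMap.mulLeft ℂ c

theorem opSqrt_isSelfAdjoint {E : Type} [NormedAddCommGroup E] [InnerProductSpace ℂ E]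
    [CompleteSpace E] (D : E →L[ℂ] E) : IsSelfAdjoint (opSqrt D) :=
  cfc_predicate Real.sqrt D

theorem opInvSqrt_isSelfAdjoint {E : Type} [NormedAddCommGroup E] [InnerProductSpace ℂ E]
    [CompleteSpace E] (D : E →L[ℂ] E) : IsSelfAdjoint (opInvSqrt D) :=
  cfc_predicate (fun t : ℝ => (Real.sqrt t)⁻¹) D

theorem opSqrt_mul_opSqrt_s15 {E : Type} [NormedAddCommGroup E] [InnerProductSpace ℂ E]
    [CompleteSpace E] {D : E →L[ℂ] E} (hD : 0 ≤ D) : opSqrt D * opSqrt D = D := by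
  have hs : IsSelfAdjoint D := .of_nonneg hD
  rw [opSqrt, ← cfc_mul Real.sqrt Real.sqrt D]
  conv_rhs => rw [← cfc_id' ℝ D]
  exact cfc_congr fun t ht => Real.mul_self_sqrt (spectrum_nonneg_of_nonneg hD ht)

theorem opSqrt_mul_opInvSqrt_s15 {E : Type} [NormedAddCommGroup E] [InnerProductSpace ℂ E]
    [CompleteSpace E] {D : E →L[ℂ] E} (hD : 0 ≤ D) (hu : IsUnit D) :
    opSqrt D * opInvSqrt D = 1 ∧ opInvSqrt D * opSqrt D = 1 := by
  have hs : IsSelfAdjoint D := .of_nonneg hD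
  have hne (t : ℝ) (ht : t ∈ spectrum ℝ D) : Real.sqrt t ≠ 0 := by
    have h0 : t ≠ 0 := by
      rintro rfl
      exact spectrum.zero_notMem ℝ hu ht
    exact (Real.sqrt_pos.2 ((spectrum_nonneg_of_nonneg hD ht).lt_of_ne' h0)).ne'
  have hc : ContinuousOn (fun t : ℝ => (Real.sqrt t)⁻¹) (spectrum ℝ D) :=
    Real.continuous_sqrt.continuousOn.inv₀ hne
  constructor
  · rw [opSqrt, opInvSqrt, ← cfc_mul Real.sqrt _ D (by fun_prop) hc, ← cfc_const_one ℝ D]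
    exact cfc_congr fun t ht => mul_inv_cancel₀ (hne t ht)
  · rw [opSqrt, opInvSqrt, ← cfc_mul _ Real.sqrt D hc (by fun_prop), ← cfc_const_one ℝ D]
    exact cfc_congr fun t ht => inv_mul_cancel₀ (hne t ht)

/-- Quantitative refinement: `∑ Φ i (f (A i)) − f(∑ Φ i (A i)) ≥
∑_{S₁} Φ i (f (A i)) − g(∑_{S₁} Φ i (A i), D₁) ≥ 0`. -/
theorem stmt_15 {K : Type} [NormedAddCommGroup K] [InnerProductSpace ℂ K] [CompleteSpace K]
    (f : ℝ → ℝ) (hf_cont : ContinuousOn f (Set.Ici (0 : ℝ)))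
    (hf : OperatorConvexOn f) (n : ℕ)
    (Φ : Fin n → (H →L[ℂ] H) →ₗ[ℂ] (K →L[ℂ] K))
    (hΦpos : ∀ i (A : H →L[ℂ] H), 0 ≤ A → 0 ≤ Φ i A)
    (hΦsum : ∑ i, Φ i 1 = 1)
    (A : Fin n → H →L[ℂ] H) (hA : ∀ i, 0 ≤ A i)
    (S₁ : Finset (Fin n)) (hne₁ : S₁.Nonempty) (hD₁ : IsUnit (∑ i ∈ S₁, Φ i 1)) :
    (∑ i, Φ i (cfc f (A i))) - cfc f (∑ i, Φ i (A i)) ≥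
        (∑ i ∈ S₁, Φ i (cfc f (A i))) -
          persp f (∑ i ∈ S₁, Φ i (A i)) (∑ i ∈ S₁, Φ i 1) ∧
      (∑ i ∈ S₁, Φ i (cfc f (A i))) -
          persp f (∑ i ∈ S₁, Φ i (A i)) (∑ i ∈ S₁, Φ i 1) ≥ 0 := by
  set D := ∑ i ∈ S₁, Φ i 1 with hD
  set L := ∑ i ∈ S₁, Φ i (A i) with hL
  set Y := ∑ i ∈ S₁, Φ i (cfc f (A i)) with hY
  have hDpos : 0 ≤ D := Finset.sum_nonneg fun i _ => hΦpos i 1 zero_le_one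
  have hLpos : 0 ≤ L := Finset.sum_nonneg fun i _ => hΦpos i _ (hA i)
  have hs := opSqrt_isSelfAdjoint D
  have hr := opInvSqrt_isSelfAdjoint D
  have hss := opSqrt_mul_opSqrt_s15 hDpos
  obtain ⟨hsr, hrs⟩ := opSqrt_mul_opInvSqrt_s15 hDpos hD₁
  have happrox (i : Fin n) : JensenApprox f (Φ i 1) (Φ i (A i)) (Φ i (cfc f (A i))) :=
    (JensenApprox.of_cfc hf_cont (hA i)).map (Φ i) (hΦpos i)
  have hS₁ : JensenApprox f D L Y := .sum S₁ fun i _ => happrox i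
  have hsLs : opSqrt D * (opInvSqrt D * L * opInvSqrt D) * opSqrt D = L := by
    simp only [mul_assoc, hrs, mul_one]
    rw [← mul_assoc, hsr, one_mul]
  constructor
  · have hpersp : JensenApprox f D L (persp f L D) := by
      have := (JensenApprox.of_cfc hf_cont (hr.conjugate_nonneg hLpos)).map
        (conjLinearMap (opSqrt D)) fun B hB => hs.conjugate_nonneg hB
      change JensenApprox f (opSqrt D * 1 * opSqrt D)
        (opSqrt D * (opInvSqrt D * L * opInvSqrt D) * opSqrt D) (persp f L D) at this
      rwa [mul_one, hss, hsLs] at this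
    have hall := hpersp.add (.sum S₁ᶜ fun i _ => happrox i)
    rw [hD, hL, Finset.sum_add_sum_compl, Finset.sum_add_sum_compl, hΦsum] at hall
    have hle := hall.cfc_le hf_cont hf
    rw [← hL, ← hD] at hle
    rw [ge_iff_le, ← Finset.sum_add_sum_compl S₁ fun i => Φ i (cfc f (A i)), ← hY, add_sub_assoc,
      sub_eq_add_neg, add_le_add_iff_left, neg_le_iff_add_nonneg]
    rw [← sub_nonneg] at hle
    convert hle using 1
    abel
  · have hunital := hS₁.map (conjLinearMap (opInvSqrt D)) fun B hB => hr.conjugate_nonneg hB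
    change JensenApprox f (opInvSqrt D * D * opInvSqrt D) (opInvSqrt D * L * opInvSqrt D)
      (opInvSqrt D * Y * opInvSqrt D) at hunital
    have hone : opInvSqrt D * D * opInvSqrt D = 1 := by
      conv_lhs => enter [1, 2]; rw [← hss]
      rw [← mul_assoc, hrs, one_mul, hsr]
    rw [hone] at hunital
    have hle := hs.conjugate_le_conjugate (hunital.cfc_le hf_cont hf)
    have hsYs : opSqrt D * (opInvSqrt D * Y * opInvSqrt D) * opSqrt D = Y := by
      simp only [mul_assoc, hrs, mul_one]
      rw [← mul_assoc, hsr, one_mul]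
    rw [hsYs] at hle
    exact sub_nonneg.2 hle
end
end
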